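/- There exist constants C > 0 and C' > 0 such that for every δ > 0 there is N such that for every n ≥ N divisible by 3 and every p with n·p ≥ C·log n, a sample G ~ 𝒢_{n,p,3} satisfies the following with probability at least 1 − δ: for every 3-coloring φ : V → Fin 3 with |{v : φ(v) ≠ φ*(v)}| ≤ n/120, the Gallager iteration on G started from φ converges at some iteration T ≤ C'·log n and B(v, m^T) = some(φ*(v)) for every v ∈ V. -/

import Mathlib

open MeasureTheory

/-- The balanced planted 3-coloring on `Fin n`: vertex `v` gets color `v mod 3`. -/
def plantedColoring (n : ℕ) (v : Fin n) : Fin 3 := ⟨v.val % 3, Nat.mod_lt _ (by norm_num)⟩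

/-- A pair of vertices is bichromatic if its two endpoints get distinct planted colors. -/
def Bichrom (n : ℕ) (e : Sym2 (Fin n)) : Prop :=
  Sym2.lift ⟨fun u v => plantedColoring n u ≠ plantedColoring n v,
    fun u v => propext ne_comm⟩ e

/-- The type of bichromatic pairs. -/
abbrev BichromPair (n : ℕ) : Type := {e : Sym2 (Fin n) // Bichrom n e}

noncomputable instance (n : ℕ) : Fintype (BichromPair n) := Fintype.ofFinite _

/-- The Bernoulli measure on `Bool` with parameter `p`. -/
noncomputable def bernoulliMeasure (p : ℝ) : Measure Bool :=
  ENNReal.ofReal p • Measure.dirac true + ENNReal.ofReal (1 - p) • Measure.dirac false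

/-- The planted 3-coloring distribution `𝒢_{n,p,3}`: the product over all bichromatic
pairs of Bernoulli(p) measures on `Bool`. -/
noncomputable def plantedMeasure (n : ℕ) (p : ℝ) : Measure (BichromPair n → Bool) :=
  Measure.pi fun _ => bernoulliMeasure p

/-- The graph of a sample point `ω`: its edges are the bichromatic pairs `e` with
`ω e = true`. -/
def plantedGraph (n : ℕ) (ω : BichromPair n → Bool) : SimpleGraph (Fin n) :=
  SimpleGraph.fromEdgeSet {e : Sym2 (Fin n) | ∃ h : Bichrom n e, ω ⟨e, h⟩ = true}

/-- `e(S)`: the number of edges of `G` with both endpoints in `S`. -/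
noncomputable def edgeCount {V : Type*} (G : SimpleGraph V) (S : Set V) : ℕ :=
  {e : Sym2 V | e ∈ G.edgeSet ∧ ∀ v ∈ e, v ∈ S}.ncard

/-- `D` is a `d`-core: every `v ∈ D` has at least `d/5` neighbors in `D ∩ V_i` for
each color class index `i ≠ φ*(v)`, and at most `d/20` neighbors outside `D`. -/
def IsCore (n : ℕ) (G : SimpleGraph (Fin n)) (d : ℝ) (D : Set (Fin n)) : Prop :=
  ∀ v ∈ D,
    (∀ i : Fin 3, i ≠ plantedColoring n v →
      d / 5 ≤ ({w : Fin n | G.Adj v w ∧ w ∈ D ∧ plantedColoring n w = i}.ncard : ℝ)) ∧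
    ({w : Fin n | G.Adj v w ∧ w ∉ D}.ncard : ℝ) ≤ d / 20

/-- `c_t(u,v,m)`: the number of neighbors `w` of `u` other than `v` with `m(w→u) = some t`. -/
noncomputable def msgCount {V : Type*} (G : SimpleGraph V)
    (m : V → V → Option (Fin 3)) (u v : V) (t : Fin 3) : ℕ :=
  {w : V | G.Adj u w ∧ w ≠ v ∧ m w u = some t}.ncard

/-- The smallest color minimizing `f`. -/
def argminFin3 (f : Fin 3 → ℕ) : Fin 3 :=
  if f 0 ≤ f 1 ∧ f 0 ≤ f 2 then 0 else if f 1 ≤ f 2 then 1 else 2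

open Classical in
/-- Gallager update (threshold τ = 1): `U(m)(u→v) = none` if at least two distinct colors
have count 0, otherwise the smallest color minimizing the count. -/
noncomputable def gallagerUpdate {V : Type*} (G : SimpleGraph V)
    (m : V → V → Option (Fin 3)) : V → V → Option (Fin 3) := fun u v =>
  if ∃ t₁ t₂ : Fin 3, t₁ ≠ t₂ ∧ msgCount G m u v t₁ = 0 ∧ msgCount G m u v t₂ = 0 then none
  else some (argminFin3 (msgCount G m u v))

/-- The number of neighbors `w` of `u` with `m(w→u) = some t`. -/
noncomputable def outCount {V : Type*} (G : SimpleGraph V)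
    (m : V → V → Option (Fin 3)) (u : V) (t : Fin 3) : ℕ :=
  {w : V | G.Adj u w ∧ m w u = some t}.ncard

open Classical in
/-- Output `B(u, m)` of a message state at a vertex `u`. -/
noncomputable def gallagerOutput {V : Type*} (G : SimpleGraph V)
    (m : V → V → Option (Fin 3)) (u : V) : Option (Fin 3) :=
  if ∃ t₁ t₂ : Fin 3, t₁ ≠ t₂ ∧ outCount G m u t₁ = 0 ∧ outCount G m u t₂ = 0 then none
  else some (argminFin3 (outCount G m u))

/-- The Gallager iterates: `m⁰(u→v) = some (φ u)`, `mⁱ⁺¹ = U(mⁱ)`. -/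
noncomputable def gallagerIter {V : Type*} (G : SimpleGraph V) (φ : V → Fin 3) :
    ℕ → V → V → Option (Fin 3)
  | 0 => fun u _ => some (φ u)
  | i + 1 => gallagerUpdate G (gallagerIter G φ i)

section Decoding

theorem argminFin3_eq {f : Fin 3 → ℕ} {a : Fin 3} (h : ∀ i, i ≠ a → f a < f i) :
    argminFin3 f = a := by
  unfold argminFin3
  have h0 := h 0
  have h1 := h 1
  have h2 := h 2
  fin_cases a <;> simp at h0 h1 h2 ⊢ <;> grind

theorem not_exists_two_zeros {f : Fin 3 → ℕ} {a : Fin 3} (h : ∀ i, i ≠ a → f a < f i) :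
    ¬ ∃ t₁ t₂ : Fin 3, t₁ ≠ t₂ ∧ f t₁ = 0 ∧ f t₂ = 0 := by
  rintro ⟨t₁, t₂, hne, h1, h2⟩
  by_cases ht : t₁ = a
  · have := h t₂ (fun h => hne (ht.trans h.symm))
    omega
  · have := h t₁ ht
    omega

variable {V : Type*} [Finite V] {G : SimpleGraph V} {c : V → Fin 3}

/-- A vertex with few wrong incoming messages and many neighbours in both other colour classes
sends its correct colour to every neighbour. -/
theorem gallagerUpdate_eq_some {m : V → V → Option (Fin 3)} {b : ℝ} {u : V}
    (hc : ∀ w, G.Adj u w → c w ≠ c u)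
    (hdeg : ∀ i, i ≠ c u → 2 * b + 1 ≤ ({w | G.Adj u w ∧ c w = i}.ncard : ℝ))
    (hbad : ({w | G.Adj u w ∧ m w u ≠ some (c w)}.ncard : ℝ) < b) (v : V) :
    gallagerUpdate G m u v = some (c u) := by
  have key : ∀ i, i ≠ c u → msgCount G m u v (c u) < msgCount G m u v i := by
    intro i hi
    have h1 : msgCount G m u v (c u) ≤ {w | G.Adj u w ∧ m w u ≠ some (c w)}.ncard := by
      refine Set.ncard_le_ncard ?_ (Set.toFinite _)
      rintro w ⟨hw, -, hm⟩
      refine ⟨hw, fun h => hc w hw ?_⟩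
      rw [hm] at h
      exact (Option.some.inj h).symm
    have h2 : {w | G.Adj u w ∧ c w = i}.ncard ≤
        msgCount G m u v i + {w | G.Adj u w ∧ m w u ≠ some (c w)}.ncard + 1 := by
      have hsub : {w | G.Adj u w ∧ c w = i} ⊆
          ({w | G.Adj u w ∧ w ≠ v ∧ m w u = some i} ∪
            {w | G.Adj u w ∧ m w u ≠ some (c w)}) ∪ {v} := by
        rintro w ⟨hw, rfl⟩
        by_cases hv : w = v
        · exact Or.inr hv
        · by_cases hm : m w u = some (c w)
          · exact Or.inl (Or.inl ⟨hw, hv, hm⟩)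
          · exact Or.inl (Or.inr ⟨hw, hm⟩)
      calc _ ≤ _ := Set.ncard_le_ncard hsub (Set.toFinite _)
        _ ≤ _ := Set.ncard_union_le _ _
        _ ≤ _ := by
          rw [Set.ncard_singleton]
          exact Nat.add_le_add_right (Set.ncard_union_le _ _) 1
    have h3 := hdeg i hi
    have h2' : ({w | G.Adj u w ∧ c w = i}.ncard : ℝ) ≤
        msgCount G m u v i + {w | G.Adj u w ∧ m w u ≠ some (c w)}.ncard + 1 := by
      exact_mod_cast h2
    have h1' : (msgCount G m u v (c u) : ℝ) ≤
        {w | G.Adj u w ∧ m w u ≠ some (c w)}.ncard := by exact_mod_cast h1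
    have : (msgCount G m u v (c u) : ℝ) < msgCount G m u v i := by linarith
    exact_mod_cast this
  unfold gallagerUpdate
  rw [if_neg (not_exists_two_zeros key), argminFin3_eq key]

/-- If all incoming messages at `u` are correct then so is the output. -/
theorem gallagerOutput_eq_some {m : V → V → Option (Fin 3)} {u : V}
    (hc : ∀ w, G.Adj u w → c w ≠ c u)
    (hdeg : ∀ i, i ≠ c u → 0 < {w | G.Adj u w ∧ c w = i}.ncard)
    (hm : ∀ w, G.Adj u w → m w u = some (c w)) :
    gallagerOutput G m u = some (c u) := by
  have hout : ∀ i, outCount G m u i = {w | G.Adj u w ∧ c w = i}.ncard := by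
    intro i
    unfold outCount
    congr 1
    ext w
    simp only [Set.mem_ofPred_eq]
    refine and_congr_right fun hw => ?_
    rw [hm w hw, Option.some_inj]
  have key : ∀ i, i ≠ c u → outCount G m u (c u) < outCount G m u i := by
    intro i hi
    have h0 : outCount G m u (c u) = 0 := by
      rw [hout, Set.ncard_eq_zero (Set.toFinite _), Set.eq_empty_iff_forall_notMem]
      rintro w ⟨hw, h⟩
      exact hc w hw h
    rw [h0, hout]
    exact hdeg i hi
  unfold gallagerOutput
  rw [if_neg (not_exists_two_zeros key), argminFin3_eq key]

/-- The vertices that send at least one wrong message. -/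
def wrongSenders (G : SimpleGraph V) (c : V → Fin 3) (m : V → V → Option (Fin 3)) : Set V :=
  {u | ∃ v, G.Adj u v ∧ m u v ≠ some (c u)}

theorem wrongSenders_gallagerUpdate_subset {m : V → V → Option (Fin 3)} {b : ℝ}
    (hc : ∀ u w, G.Adj u w → c w ≠ c u)
    (hdeg : ∀ u i, i ≠ c u → 2 * b + 1 ≤ ({w | G.Adj u w ∧ c w = i}.ncard : ℝ)) :
    wrongSenders G c (gallagerUpdate G m) ⊆
      {u | b ≤ ({w | G.Adj u w ∧ w ∈ wrongSenders G c m}.ncard : ℝ)} := by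
  rintro u ⟨v, -, huv⟩
  by_contra hlt
  simp only [Set.mem_ofPred_eq, not_le] at hlt
  refine huv (gallagerUpdate_eq_some (hc u) (hdeg u) (lt_of_le_of_lt ?_ hlt) v)
  refine Nat.cast_le.2 (Set.ncard_le_ncard ?_ (Set.toFinite _))
  exact fun w hw => ⟨hw.1, u, hw.1.symm, hw.2⟩

theorem gallager_converges_of_contraction {b K : ℝ} (hb : 0 < b)
    (hc : ∀ u w, G.Adj u w → c w ≠ c u)
    (hdeg : ∀ u i, i ≠ c u → 2 * b + 1 ≤ ({w | G.Adj u w ∧ c w = i}.ncard : ℝ))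
    (hexp : ∀ S : Set V, (S.ncard : ℝ) ≤ K →
      2 * {u | b ≤ ({w | G.Adj u w ∧ w ∈ S}.ncard : ℝ)}.ncard ≤ S.ncard)
    {φ : V → Fin 3} (hφ : ({v | φ v ≠ c v}.ncard : ℝ) ≤ K) {T : ℕ} (hT : K < 2 ^ T) :
    (∀ u v, G.Adj u v → gallagerIter G φ (T + 1) u v = gallagerIter G φ T u v) ∧
      ∀ v, gallagerOutput G (gallagerIter G φ T) v = some (c v) := by
  have h0 : ((wrongSenders G c (gallagerIter G φ 0)).ncard : ℝ) ≤ K := by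
    refine le_trans ?_ hφ
    refine Nat.cast_le.2 (Set.ncard_le_ncard ?_ (Set.toFinite _))
    rintro u ⟨v, -, h⟩
    exact fun h' => h (congrArg some h')
  have hstep : ∀ i, 2 ^ i * ((wrongSenders G c (gallagerIter G φ i)).ncard : ℝ) ≤ K := by
    intro i
    induction i with
    | zero => simpa using h0
    | succ i ih =>
      have hle : ((wrongSenders G c (gallagerIter G φ i)).ncard : ℝ) ≤ K := by
        refine le_trans ?_ ih
        exact le_mul_of_one_le_left (Nat.cast_nonneg _) (one_le_pow₀ (by norm_num))
      have h1 := hexp _ hle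
      have h2 := Set.ncard_le_ncard
        (wrongSenders_gallagerUpdate_subset (m := gallagerIter G φ i) hc hdeg) (Set.toFinite _)
      have h3 : (2 : ℝ) * ((wrongSenders G c (gallagerIter G φ (i + 1))).ncard : ℝ) ≤
          (wrongSenders G c (gallagerIter G φ i)).ncard := by
        have : 2 * (wrongSenders G c (gallagerIter G φ (i + 1))).ncard ≤
          (wrongSenders G c (gallagerIter G φ i)).ncard := le_trans (Nat.mul_le_mul_left 2 h2) h1
        exact_mod_cast this
      calc _ = 2 ^ i * (2 * ((wrongSenders G c (gallagerIter G φ (i + 1))).ncard : ℝ)) := by ring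
        _ ≤ _ := by gcongr
        _ ≤ K := ih
  have hempty : wrongSenders G c (gallagerIter G φ T) = ∅ := by
    rw [← Set.ncard_eq_zero (Set.toFinite _)]
    by_contra hne
    have h1 : (1 : ℝ) ≤ (wrongSenders G c (gallagerIter G φ T)).ncard := by
      exact_mod_cast Nat.one_le_iff_ne_zero.2 hne
    have h2 := hstep T
    have h3 : (2 : ℝ) ^ T * 1 ≤ 2 ^ T * (wrongSenders G c (gallagerIter G φ T)).ncard := by gcongr
    linarith
  have hcorrect : ∀ u v, G.Adj u v → gallagerIter G φ T u v = some (c u) := by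
    intro u v huv
    by_contra hne
    have : u ∈ wrongSenders G c (gallagerIter G φ T) := ⟨v, huv, hne⟩
    simp [hempty] at this
  refine ⟨fun u v huv => ?_, fun v => gallagerOutput_eq_some (hc v) (fun i hi => ?_)
    fun w hw => hcorrect w v hw.symm⟩
  · rw [hcorrect u v huv]
    refine gallagerUpdate_eq_some (b := b) (hc u) (hdeg u) ?_ v
    have : {w | G.Adj u w ∧ gallagerIter G φ T w u ≠ some (c w)} = ∅ :=
      Set.eq_empty_iff_forall_notMem.2 fun w hw => hw.2 (hcorrect w u hw.1.symm)
    rw [this]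
    simpa using hb
  · have := hdeg v i hi
    have : (0 : ℝ) < {w | G.Adj v w ∧ c w = i}.ncard := by linarith
    exact_mod_cast this

end Decoding

section Concentration

/-- The number of present edges among a set `F` of bichromatic pairs. -/
def presentCount {n : ℕ} (F : Finset (BichromPair n)) (ω : BichromPair n → Bool) : ℕ :=
  (F.filter fun e => ω e = true).card

theorem isProbabilityMeasure_bernoulliMeasure {p : ℝ} (hp0 : 0 ≤ p) (hp1 : p ≤ 1) :
    IsProbabilityMeasure (bernoulliMeasure p) := by
  constructor
  simp only [bernoulliMeasure, Measure.add_apply, Measure.smul_apply, measure_univ, smul_eq_mul,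
    mul_one]
  rw [← ENNReal.ofReal_add hp0 (by linarith)]
  simp

theorem integral_bernoulliMeasure {p : ℝ} (hp0 : 0 ≤ p) (hp1 : p ≤ 1) (f : Bool → ℝ) :
    ∫ x, f x ∂(bernoulliMeasure p) = p * f true + (1 - p) * f false := by
  have := isProbabilityMeasure_bernoulliMeasure hp0 hp1
  rw [bernoulliMeasure, integral_add_measure, integral_smul_measure, integral_smul_measure,
    integral_dirac, integral_dirac, ENNReal.toReal_ofReal hp0,
    ENNReal.toReal_ofReal (by linarith)]
  · simp
  · exact (integrable_dirac (by simp)).smul_measure (by simp)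
  · exact (integrable_dirac (by simp)).smul_measure (by simp)

theorem isProbabilityMeasure_plantedMeasure {n : ℕ} {p : ℝ} (hp0 : 0 ≤ p) (hp1 : p ≤ 1) :
    IsProbabilityMeasure (plantedMeasure n p) := by
  have := isProbabilityMeasure_bernoulliMeasure hp0 hp1
  unfold plantedMeasure
  infer_instance

theorem integral_exp_presentCount_le {n : ℕ} {p : ℝ} (hp0 : 0 ≤ p) (hp1 : p ≤ 1)
    (F : Finset (BichromPair n)) (L : ℝ) :
    ∫ ω, Real.exp (L * presentCount F ω) ∂(plantedMeasure n p) ≤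
      Real.exp (p * F.card * (Real.exp L - 1)) := by
  classical
  have := isProbabilityMeasure_bernoulliMeasure hp0 hp1
  have hprod : ∀ ω : BichromPair n → Bool, Real.exp (L * presentCount F ω) =
      ∏ e, (if e ∈ F then (if ω e = true then Real.exp L else 1) else 1) := by
    intro ω
    rw [Finset.prod_ite_mem, Finset.univ_inter, Finset.prod_ite, Finset.prod_const,
      Finset.prod_const_one, mul_one, ← Real.exp_nat_mul, mul_comm, presentCount]
  simp only [hprod]
  rw [plantedMeasure, integral_fintype_prod_eq_prod (μ := fun _ => bernoulliMeasure p)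
    (f := fun e b => if e ∈ F then (if b = true then Real.exp L else 1) else (1 : ℝ))]
  have hint : ∀ e : BichromPair n,
      ∫ b, (if e ∈ F then (if b = true then Real.exp L else 1) else (1 : ℝ))
        ∂(bernoulliMeasure p) = if e ∈ F then 1 + p * (Real.exp L - 1) else 1 := by
    intro e
    rw [integral_bernoulliMeasure hp0 hp1]
    by_cases he : e ∈ F
    · simp only [he, if_true, Bool.false_eq_true, if_false]
      ring
    · simp only [he, if_false]
      ring
  rw [Finset.prod_congr rfl fun e _ => hint e, Finset.prod_ite_mem, Finset.univ_inter,
    Finset.prod_const]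
  have hnn : 0 ≤ 1 + p * (Real.exp L - 1) := by
    have := Real.exp_pos L
    nlinarith
  calc _ ≤ Real.exp (p * (Real.exp L - 1)) ^ F.card := by
        gcongr
        rw [add_comm]
        exact Real.add_one_le_exp _
    _ = _ := by
        rw [← Real.exp_nat_mul]
        ring_nf

/-- Chernoff's bound for the number of present edges in `F`, with a free parameter `L`. -/
theorem measureReal_presentCount_le {n : ℕ} {p : ℝ} (hp0 : 0 ≤ p) (hp1 : p ≤ 1)
    (F : Finset (BichromPair n)) (L a : ℝ) :
    (plantedMeasure n p).real {ω | a ≤ L * presentCount F ω} ≤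
      Real.exp (-a + p * F.card * (Real.exp L - 1)) := by
  have := isProbabilityMeasure_plantedMeasure (n := n) hp0 hp1
  have h := ProbabilityTheory.measure_ge_le_exp_mul_mgf (μ := plantedMeasure n p)
    (X := fun ω => L * presentCount F ω) (t := 1) a zero_le_one Integrable.of_finite
  refine h.trans ?_
  rw [Real.exp_add, neg_one_mul]
  gcongr
  simpa [ProbabilityTheory.mgf] using integral_exp_presentCount_le hp0 hp1 F L

end Concentration

section Edges

variable {n : ℕ}

open Classical in
/-- The bichromatic pairs with one endpoint in `T` and the other in `S`. -/
noncomputable def pairsBetween (T S : Finset (Fin n)) : Finset (BichromPair n) :=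
  Finset.univ.filter fun e => ∃ u ∈ T, ∃ w ∈ S, e.1 = s(u, w)

theorem plantedGraph_adj {ω : BichromPair n → Bool} {u w : Fin n} :
    (plantedGraph n ω).Adj u w ↔ ∃ h : Bichrom n s(u, w), ω ⟨s(u, w), h⟩ = true := by
  unfold plantedGraph
  rw [SimpleGraph.fromEdgeSet_adj]
  refine ⟨fun h => h.1, fun h => ⟨h, ?_⟩⟩
  rintro rfl
  exact h.1 rfl

theorem plantedColoring_ne_of_adj {ω : BichromPair n → Bool} {u w : Fin n}
    (h : (plantedGraph n ω).Adj u w) : plantedColoring n w ≠ plantedColoring n u := by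
  obtain ⟨h, -⟩ := plantedGraph_adj.1 h
  exact fun h' => h h'.symm

theorem card_pairsBetween_le (T S : Finset (Fin n)) :
    (pairsBetween T S).card ≤ T.card * S.card := by
  classical
  rw [← Finset.card_product, ← Finset.card_image_of_injective _ Subtype.val_injective]
  refine le_trans (Finset.card_le_card (t := (T ×ˢ S).image fun x => s(x.1, x.2)) ?_)
    Finset.card_image_le
  intro e he
  obtain ⟨e, he', rfl⟩ := Finset.mem_image.1 he
  obtain ⟨-, u, hu, w, hw, h⟩ := Finset.mem_filter.1 he'
  exact Finset.mem_image.2 ⟨(u, w), Finset.mk_mem_product hu hw, h.symm⟩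

theorem sum_ncard_adj_le (ω : BichromPair n → Bool) (T S : Finset (Fin n)) :
    ∑ u ∈ T, {w | (plantedGraph n ω).Adj u w ∧ w ∈ S}.ncard ≤
      2 * presentCount (pairsBetween T S) ω := by
  classical
  have h1 : ∀ u, {w | (plantedGraph n ω).Adj u w ∧ w ∈ S}.ncard =
      (S.filter fun w => (plantedGraph n ω).Adj u w).card := by
    intro u
    rw [← Set.ncard_coe_finset]
    congr 1
    ext w
    simp [and_comm]
  simp only [h1]
  rw [← Finset.card_sigma]
  set P := T.sigma fun u => S.filter fun w => (plantedGraph n ω).Adj u w with hP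
  have h2 : P.card ≤ 2 * (P.image fun x => s(x.1, x.2)).card := by
    refine Finset.card_le_mul_card_image _ _ fun e he => ?_
    obtain ⟨x, -, rfl⟩ := Finset.mem_image.1 he
    refine le_trans (Finset.card_le_card (t := {x, ⟨x.2, x.1⟩}) ?_) Finset.card_le_two
    rintro ⟨a, b⟩ hy
    obtain ⟨-, hy⟩ := Finset.mem_filter.1 hy
    obtain ⟨x, y⟩ := x
    rcases Sym2.eq_iff.1 hy with ⟨h, h'⟩ | ⟨h, h'⟩ <;> simp_all
  refine h2.trans (Nat.mul_le_mul_left 2 ?_)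
  rw [presentCount, ← Finset.card_image_of_injective _ Subtype.val_injective]
  refine Finset.card_le_card fun e he => ?_
  obtain ⟨⟨u, w⟩, hx, rfl⟩ := Finset.mem_image.1 he
  simp only [hP, Finset.mem_sigma, Finset.mem_filter] at hx
  obtain ⟨hu, hw, hadj⟩ := hx
  obtain ⟨h, hω⟩ := plantedGraph_adj.1 hadj
  refine Finset.mem_image.2 ⟨⟨_, h⟩, Finset.mem_filter.2 ⟨?_, hω⟩, rfl⟩
  exact Finset.mem_filter.2 ⟨Finset.mem_univ _, u, hu, w, hw, rfl⟩

theorem div_three_le_card_colorClass (h3 : 3 ∣ n) (i : Fin 3) :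
    n / 3 ≤ (Finset.univ.filter fun w => plantedColoring n w = i).card := by
  obtain ⟨k, rfl⟩ := h3
  rw [Nat.mul_div_cancel_left _ (by norm_num)]
  let f : Fin k → Fin (3 * k) := fun j => ⟨3 * j + i, by omega⟩
  have hf : Function.Injective f := by
    intro a b hab
    have := congrArg Fin.val hab
    simp only [f] at this
    omega
  calc k = (Finset.univ.image f).card := by
        rw [Finset.card_image_of_injective _ hf, Finset.card_univ, Fintype.card_fin]
    _ ≤ _ := by
        refine Finset.card_le_card fun w hw => ?_
        obtain ⟨j, -, rfl⟩ := Finset.mem_image.1 hw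
        refine Finset.mem_filter.2 ⟨Finset.mem_univ _, Fin.ext ?_⟩
        simp only [plantedColoring, f]
        omega

theorem div_three_le_card_pairsBetween (h3 : 3 ∣ n) {v : Fin n} {i : Fin 3}
    (hi : i ≠ plantedColoring n v) :
    n / 3 ≤ (pairsBetween {v} (Finset.univ.filter fun w => plantedColoring n w = i)).card := by
  classical
  refine (div_three_le_card_colorClass h3 i).trans ?_
  have hinj : Function.Injective fun w => s(v, w) := fun a b h => Sym2.congr_right.1 h
  rw [← Finset.card_image_of_injective _ hinj,
    ← Finset.card_image_of_injective (pairsBetween _ _) Subtype.val_injective]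
  refine Finset.card_le_card fun e he => ?_
  obtain ⟨w, hw, rfl⟩ := Finset.mem_image.1 he
  have hcw := (Finset.mem_filter.1 hw).2
  have hb : Bichrom n s(v, w) := fun h => hi (hcw.symm.trans h.symm)
  refine Finset.mem_image.2 ⟨⟨_, hb⟩, Finset.mem_filter.2 ⟨Finset.mem_univ _, ?_⟩, rfl⟩
  exact ⟨v, Finset.mem_singleton_self v, w, hw, rfl⟩

theorem presentCount_pairsBetween_le_ncard (ω : BichromPair n → Bool) (v : Fin n) (i : Fin 3) :
    presentCount (pairsBetween {v} (Finset.univ.filter fun w => plantedColoring n w = i)) ω ≤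
      {w | (plantedGraph n ω).Adj v w ∧ plantedColoring n w = i}.ncard := by
  classical
  rw [presentCount, ← Finset.card_image_of_injective _ Subtype.val_injective,
    ← Set.ncard_coe_finset]
  refine le_trans (Set.ncard_le_ncard (t := (fun w => s(v, w)) '' _) ?_ (Set.toFinite _))
    (Set.ncard_image_le (Set.toFinite _))
  intro e he
  obtain ⟨⟨e, hb⟩, he', rfl⟩ := Finset.mem_image.1 (Finset.mem_coe.1 he)
  obtain ⟨hF, hω⟩ := Finset.mem_filter.1 he'
  obtain ⟨-, u, hu, w, hw, h⟩ := Finset.mem_filter.1 hF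
  obtain rfl := Finset.mem_singleton.1 hu
  dsimp only at h
  subst h
  exact ⟨w, ⟨plantedGraph_adj.2 ⟨hb, hω⟩, (Finset.mem_filter.1 hw).2⟩, rfl⟩

/-- The vertex `x.1` has fewer than `np/6` present edges to the colour class `x.2`, different from its own. -/
def degreeDeficient (n : ℕ) (p : ℝ) (x : Fin n × Fin 3) : Set (BichromPair n → Bool) :=
  {ω | x.2 ≠ plantedColoring n x.1 ∧
    (presentCount (pairsBetween {x.1}
      (Finset.univ.filter fun w => plantedColoring n w = x.2)) ω : ℝ) < n * p / 6}

/-- The nonempty set `x.1` has too many present edges to the small set `x.2`. -/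
def overConnected (n : ℕ) (p : ℝ) (x : Finset (Fin n) × Finset (Fin n)) :
    Set (BichromPair n → Bool) :=
  {ω | x.1.Nonempty ∧ x.2.card ≤ 2 * x.1.card ∧ (x.2.card : ℝ) ≤ n / 120 ∧
    x.1.card * (n * p / 32) ≤ presentCount (pairsBetween x.1 x.2) ω}

theorem measureReal_degreeDeficient_le (h3 : 3 ∣ n) {p : ℝ} (hp0 : 0 ≤ p) (hp1 : p ≤ 1)
    (x : Fin n × Fin 3) :
    (plantedMeasure n p).real (degreeDeficient n p x) ≤ Real.exp (-(n * p / 180)) := by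
  have := isProbabilityMeasure_plantedMeasure (n := n) hp0 hp1
  by_cases hx : x.2 = plantedColoring n x.1
  · have : degreeDeficient n p x = ∅ :=
      Set.eq_empty_iff_forall_notMem.2 fun ω hω => hω.1 hx
    rw [this, measureReal_empty]
    positivity
  set F := pairsBetween {x.1} (Finset.univ.filter fun w => plantedColoring n w = x.2) with hF
  have hsub : degreeDeficient n p x ⊆ {ω | -(n * p / 6) ≤ -1 * (presentCount F ω : ℝ)} := by
    intro ω hω
    have := hω.2
    simp only [Set.mem_ofPred_eq]
    linarith
  refine (measureReal_mono hsub).trans ((measureReal_presentCount_le hp0 hp1 F _ _).trans ?_)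
  refine Real.exp_le_exp.2 ?_
  have hcard : (n : ℝ) ≤ 3 * F.card := by
    have h : n / 3 ≤ F.card := div_three_le_card_pairsBetween h3 hx
    have : n ≤ 3 * F.card := by omega
    exact_mod_cast this
  have he : Real.exp (-1) - 1 ≤ -(63 / 100) := by
    have := Real.exp_neg_one_lt_d9
    linarith
  have hnp : 0 ≤ p * n := by positivity
  have h1 : p * n ≤ 3 * (p * F.card) := by nlinarith
  have h2 : p * F.card * (Real.exp (-1) - 1) ≤ p * F.card * (-(63 / 100)) := by gcongr
  linarith

theorem measureReal_overConnected_le {p : ℝ} (hp0 : 0 ≤ p) (hp1 : p ≤ 1)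
    (x : Finset (Fin n) × Finset (Fin n)) :
    (plantedMeasure n p).real (overConnected n p x) ≤
      if x.1 = ∅ then 0 else Real.exp (-(n * p / 180)) ^ x.1.card *
        Real.exp (-(n * p / 180)) ^ x.2.card := by
  have := isProbabilityMeasure_plantedMeasure (n := n) hp0 hp1
  by_cases hx : x.1.Nonempty ∧ x.2.card ≤ 2 * x.1.card ∧ (x.2.card : ℝ) ≤ n / 120
  swap
  · have : overConnected n p x = ∅ :=
      Set.eq_empty_iff_forall_notMem.2 fun ω hω => hx ⟨hω.1, hω.2.1, hω.2.2.1⟩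
    rw [this, measureReal_empty]
    split_ifs <;> positivity
  obtain ⟨hne, hST, hS⟩ := hx
  rw [if_neg hne.ne_empty]
  set F := pairsBetween x.1 x.2 with hF
  have hsub : overConnected n p x ⊆
      {ω | x.1.card * (n * p / 32) ≤ 1 * (presentCount F ω : ℝ)} := by
    intro ω hω
    have := hω.2.2.2
    simp only [Set.mem_ofPred_eq]
    linarith
  refine (measureReal_mono hsub).trans ((measureReal_presentCount_le hp0 hp1 F _ _).trans ?_)
  rw [← Real.exp_nat_mul, ← Real.exp_nat_mul, ← Real.exp_add]
  refine Real.exp_le_exp.2 ?_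
  have hcard : (F.card : ℝ) ≤ x.1.card * x.2.card := by
    exact_mod_cast card_pairsBetween_le x.1 x.2
  have hST' : (x.2.card : ℝ) ≤ 2 * x.1.card := by exact_mod_cast hST
  have he : Real.exp 1 - 1 ≤ 172 / 100 := by
    have := Real.exp_one_lt_d9
    linarith
  have h1 : p * F.card * (Real.exp 1 - 1) ≤ p * (x.1.card * (n / 120)) * (172 / 100) := by
    have h0 : 0 ≤ Real.exp 1 - 1 := by
      have := Real.add_one_le_exp 1
      linarith
    have : (F.card : ℝ) ≤ x.1.card * (n / 120) := hcard.trans (by gcongr)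
    gcongr
  have h2 : (x.2.card : ℝ) * (n * p / 180) ≤ 2 * x.1.card * (n * p / 180) := by gcongr
  have h3 : 0 ≤ (x.1.card : ℝ) * (n * p) := by positivity
  linarith

theorem two_mul_ncard_le_of_notMem_overConnected {p : ℝ}
    {ω : BichromPair n → Bool} (hω : ∀ x, ω ∉ overConnected n p x)
    {S : Set (Fin n)} (hS : (S.ncard : ℝ) ≤ n / 120) :
    2 * {u | n * p / 16 ≤ ({w | (plantedGraph n ω).Adj u w ∧ w ∈ S}.ncard : ℝ)}.ncard ≤
      S.ncard := by
  classical
  by_contra! hlt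
  set T := {u | n * p / 16 ≤ ({w | (plantedGraph n ω).Adj u w ∧ w ∈ S}.ncard : ℝ)} with hT
  rw [Set.ncard_eq_toFinset_card' S, Set.ncard_eq_toFinset_card' T] at hlt
  rw [Set.ncard_eq_toFinset_card' S] at hS
  have hne : 0 < T.toFinset.card := by omega
  refine hω (T.toFinset, S.toFinset) ⟨Finset.card_pos.1 hne, hlt.le, hS, ?_⟩
  have h1 := sum_ncard_adj_le ω T.toFinset S.toFinset
  have h2 : ((∑ u ∈ T.toFinset,
      {w | (plantedGraph n ω).Adj u w ∧ w ∈ S.toFinset}.ncard : ℕ) : ℝ) ≤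
        2 * presentCount (pairsBetween T.toFinset S.toFinset) ω := by exact_mod_cast h1
  have h3 : T.toFinset.card * (n * p / 16) ≤ ((∑ u ∈ T.toFinset,
      {w | (plantedGraph n ω).Adj u w ∧ w ∈ S.toFinset}.ncard : ℕ) : ℝ) := by
    rw [Nat.cast_sum, ← nsmul_eq_mul]
    refine Finset.card_nsmul_le_sum _ _ _ fun u hu => ?_
    have := Set.mem_toFinset.1 hu
    simpa [hT] using this
  dsimp only
  linarith

end Edges

theorem sum_ite_pow_mul_pow_le {n : ℕ} {x : ℝ} (hx : 0 ≤ x) (hnx : n * x ≤ 1) :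
    ∑ P : Finset (Fin n) × Finset (Fin n),
      (if P.1 = ∅ then 0 else x ^ P.1.card * x ^ P.2.card) ≤ 9 * (n * x) := by
  classical
  have hsum : ∑ S : Finset (Fin n), x ^ S.card = (x + 1) ^ n := by
    have := Fintype.sum_pow_mul_eq_add_pow (Fin n) x 1
    simpa using this
  have hsum' : ∑ S : Finset (Fin n), (if S = ∅ then 0 else x ^ S.card) = (x + 1) ^ n - 1 := by
    rw [← hsum, eq_sub_iff_add_eq]
    have : ∑ S : Finset (Fin n), (if S = ∅ then (1 : ℝ) else 0) = 1 := by simp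
    rw [← congrArg (_ + ·) this, ← Finset.sum_add_distrib]
    refine Finset.sum_congr rfl fun S _ => ?_
    split_ifs with h <;> simp [h]
  have hfac : ∑ P : Finset (Fin n) × Finset (Fin n),
      (if P.1 = ∅ then 0 else x ^ P.1.card * x ^ P.2.card) = ((x + 1) ^ n - 1) * (x + 1) ^ n := by
    rw [← hsum', ← hsum, Finset.sum_mul_sum, ← Finset.sum_product']
    refine Finset.sum_congr rfl fun P _ => ?_
    split_ifs <;> simp
  rw [hfac]
  have hy : 0 ≤ n * x := by positivity
  have h1 : (x + 1) ^ n ≤ Real.exp (n * x) := by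
    rw [Real.exp_nat_mul]
    gcongr
    exact Real.add_one_le_exp x
  have h2 : Real.exp (n * x) ≤ 3 := by
    refine (Real.exp_le_exp.2 hnx).trans ?_
    have := Real.exp_one_lt_d9
    linarith
  have h3 : Real.exp (n * x) - 1 ≤ n * x * Real.exp (n * x) := by
    have h := Real.add_one_le_exp (-(n * x))
    have hmul : Real.exp (-(n * x)) * Real.exp (n * x) = 1 := by
      rw [← Real.exp_add]
      simp
    nlinarith [Real.exp_pos (n * x)]
  have h4 : 0 ≤ (x + 1) ^ n - 1 := sub_nonneg.2 (one_le_pow₀ (by linarith))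
  calc ((x + 1) ^ n - 1) * (x + 1) ^ n ≤ (n * x * 3) * 3 := by
        refine mul_le_mul ?_ (h1.trans h2) (by positivity) (by positivity)
        nlinarith
    _ = 9 * (n * x) := by ring

/-- Some vertex is degree deficient or some pair of small sets is overconnected only with
probability `O(n exp (-np/180))`. -/
theorem measureReal_atypical_le {n : ℕ} (h3 : 3 ∣ n) {p : ℝ} (hp0 : 0 ≤ p) (hp1 : p ≤ 1)
    (hn : n * Real.exp (-(n * p / 180)) ≤ 1) :
    (plantedMeasure n p).real
        ((⋃ x, degreeDeficient n p x) ∪ ⋃ x, overConnected n p x) ≤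
      12 * (n * Real.exp (-(n * p / 180))) := by
  have h1 : (plantedMeasure n p).real (⋃ x, degreeDeficient n p x) ≤
      3 * (n * Real.exp (-(n * p / 180))) := by
    refine (measureReal_iUnion_fintype_le _).trans ?_
    refine (Finset.sum_le_sum fun x _ => measureReal_degreeDeficient_le h3 hp0 hp1 x).trans ?_
    simp only [Finset.sum_const, Finset.card_univ, Fintype.card_prod, Fintype.card_fin,
      nsmul_eq_mul]
    push_cast
    linarith
  have h2 : (plantedMeasure n p).real (⋃ x, overConnected n p x) ≤
      9 * (n * Real.exp (-(n * p / 180))) := by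
    refine (measureReal_iUnion_fintype_le _).trans ?_
    refine (Finset.sum_le_sum fun x _ => measureReal_overConnected_le hp0 hp1 x).trans ?_
    exact sum_ite_pow_mul_pow_le (Real.exp_pos _).le hn
  have := measureReal_union_le (μ := plantedMeasure n p)
    (⋃ x, degreeDeficient n p x) (⋃ x, overConnected n p x)
  linarith

theorem gallager_converges_of_typical {n : ℕ} {p : ℝ} (hnp : 24 ≤ n * p)
    {ω : BichromPair n → Bool} (hdeg : ∀ x, ω ∉ degreeDeficient n p x)
    (hexp : ∀ x, ω ∉ overConnected n p x) {φ : Fin n → Fin 3}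
    (hφ : ({v : Fin n | φ v ≠ plantedColoring n v}.ncard : ℝ) ≤ (n : ℝ) / 120)
    {T : ℕ} (hT : n < 2 ^ T) :
    (∀ u v : Fin n, (plantedGraph n ω).Adj u v →
        gallagerIter (plantedGraph n ω) φ (T + 1) u v =
          gallagerIter (plantedGraph n ω) φ T u v) ∧
      ∀ v : Fin n, gallagerOutput (plantedGraph n ω) (gallagerIter (plantedGraph n ω) φ T) v =
        some (plantedColoring n v) := by
  refine gallager_converges_of_contraction (b := n * p / 16) (K := n / 120) (by linarith)
    (fun u w h => plantedColoring_ne_of_adj h) (fun u i hi => ?_)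
    (fun S hS => two_mul_ncard_le_of_notMem_overConnected hexp hS) hφ ?_
  · have h1 : n * p / 6 ≤ (presentCount (pairsBetween {u}
        (Finset.univ.filter fun w => plantedColoring n w = i)) ω : ℝ) := by
      by_contra! hlt
      exact hdeg (u, i) ⟨hi, hlt⟩
    have h2 : (presentCount (pairsBetween {u}
        (Finset.univ.filter fun w => plantedColoring n w = i)) ω : ℝ) ≤
          {w | (plantedGraph n ω).Adj u w ∧ plantedColoring n w = i}.ncard := by
      exact_mod_cast presentCount_pairsBetween_le_ncard ω u i
    linarith
  · have : (n : ℝ) < 2 ^ T := by exact_mod_cast hT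
    have : (0 : ℝ) ≤ n := Nat.cast_nonneg n
    linarith

/-- In the dense regime `np ≥ C log n`, whp Gallager started from any coloring
at distance at most `n/120` from the planted one converges in `O(log n)` iterations and its
output is the planted coloring at every vertex. -/
theorem gallager_on_planted_model_dense :
    ∃ C C' : ℝ, 0 < C ∧ 0 < C' ∧
      ∀ δ : ℝ, 0 < δ → ∃ N : ℕ,
        ∀ n : ℕ, N ≤ n → 3 ∣ n → ∀ p : ℝ, 0 ≤ p → p ≤ 1 → C * Real.log n ≤ n * p →
          ENNReal.ofReal (1 - δ) ≤
            plantedMeasure n p {ω : BichromPair n → Bool |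
              ∀ φ : Fin n → Fin 3,
                ({v : Fin n | φ v ≠ plantedColoring n v}.ncard : ℝ) ≤ (n : ℝ) / 120 →
                ∃ T : ℕ, (T : ℝ) ≤ C' * Real.log n ∧
                  (∀ u v : Fin n, (plantedGraph n ω).Adj u v →
                      gallagerIter (plantedGraph n ω) φ (T + 1) u v =
                        gallagerIter (plantedGraph n ω) φ T u v) ∧
                  (∀ v : Fin n,
                      gallagerOutput (plantedGraph n ω) (gallagerIter (plantedGraph n ω) φ T) v =
                        some (plantedColoring n v))} := by
  refine ⟨540, 3, by norm_num, by norm_num, fun δ hδ => ⟨max 3 ⌈12 / δ⌉₊, ?_⟩⟩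
  intro n hn h3 p hp0 hp1 hnp
  have hn3 : (3 : ℝ) ≤ n := by exact_mod_cast (le_max_left _ _).trans hn
  have hnδ : 12 / δ ≤ n := (Nat.le_ceil _).trans (by exact_mod_cast (le_max_right _ _).trans hn)
  have hn0 : (0 : ℝ) < n := by linarith
  have hlog : 1 ≤ Real.log n := by
    rw [Real.le_log_iff_exp_le hn0]
    have := Real.exp_one_lt_d9
    linarith
  have hx : Real.exp (-(n * p / 180)) ≤ 1 / n ^ 2 := by
    calc Real.exp (-(n * p / 180)) ≤ Real.exp (-((2 : ℕ) * Real.log n)) := by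
          refine Real.exp_le_exp.2 ?_
          push_cast
          linarith
      _ = 1 / n ^ 2 := by rw [Real.exp_neg, Real.exp_nat_mul, Real.exp_log hn0, one_div]
  have hnx : n * Real.exp (-(n * p / 180)) ≤ 1 / n := by
    calc n * Real.exp (-(n * p / 180)) ≤ n * (1 / n ^ 2) := by gcongr
      _ = 1 / n := by field_simp
  have hprob := isProbabilityMeasure_plantedMeasure (n := n) hp0 hp1
  have hbad := measureReal_atypical_le h3 hp0 hp1
    (hnx.trans ((div_le_one hn0).2 (by linarith)))
  set B := (⋃ x, degreeDeficient n p x) ∪ ⋃ x, overConnected n p x with hB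
  have hBδ : (plantedMeasure n p).real B ≤ δ := by
    have h12 : 12 / (n : ℝ) ≤ δ := by
      rw [div_le_iff₀ hδ] at hnδ
      rw [div_le_iff₀ hn0]
      linarith
    calc _ ≤ _ := hbad
      _ ≤ 12 * (1 / n) := by gcongr
      _ = 12 / n := by ring
      _ ≤ δ := h12
  have hcompl : ENNReal.ofReal (1 - δ) ≤ plantedMeasure n p Bᶜ := by
    rw [← ofReal_measureReal, probReal_compl_eq_one_sub (Set.toFinite B).measurableSet]
    exact ENNReal.ofReal_le_ofReal (by linarith)
  refine hcompl.trans (measure_mono fun ω hω φ hφ => ?_)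
  simp only [hB, Set.mem_compl_iff, Set.mem_union, Set.mem_iUnion, not_or, not_exists] at hω
  refine ⟨Nat.log 2 n + 1, ?_, gallager_converges_of_typical (by linarith) hω.1 hω.2 hφ
    (Nat.lt_pow_succ_log_self (by norm_num) n)⟩
  have h2 : (2 : ℝ) ^ Nat.log 2 n ≤ n := by
    exact_mod_cast Nat.pow_log_le_self 2 (by rintro rfl; simp at hn0)
  have h4 := Real.log_le_log (by positivity) h2
  rw [Real.log_pow] at h4
  have h5 := Real.log_two_gt_d9
  have h6 : (Nat.log 2 n : ℝ) * (1 / 2) ≤ Nat.log 2 n * Real.log 2 := by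
    gcongr
    linarith
  push_cast
  linarith
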